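/- arXiv:2410.21114 — 2 statements merged into one kernel-verified Lean document; each statement's English description precedes it below -/
import Mathlib

section
/- (Rankine–Hugoniot right-derivative of discontinuity curves.) Let t₀ ≥ 0 and let x : (t₀, ∞) → ℝ be a continuous function with u⁺(x(t),t) < u⁻(x(t),t) for every t > t₀ (a curve along which the entropy solution is discontinuous). Then for every t > t₀ the curve is differentiable from the right at t, with lim_{h→0⁺} (x(t+h) − x(t))/h = ( f(u⁻(x(t),t)) − f(u⁺(x(t),t)) ) / ( u⁻(x(t),t) − u⁺(x(t),t) ). Moreover this right-derivative lies strictly between f'(u⁺(x(t),t)) and f'(u⁻(x(t),t)). -/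
open MeasureTheory Filter Set

noncomputable def eFun (f φ : ℝ → ℝ) (u x t : ℝ) : ℝ :=
  t * (∫ s in (0:ℝ)..u, deriv (deriv f) s * (φ (x - t * deriv f s) - s))

def maxSet (f φ : ℝ → ℝ) (x t : ℝ) : Set ℝ :=
  {w : ℝ | ∀ v : ℝ, eFun f φ v x t ≤ eFun f φ w x t}

noncomputable def uPlus (f φ : ℝ → ℝ) (x t : ℝ) : ℝ := sInf (maxSet f φ x t)

noncomputable def uMinus (f φ : ℝ → ℝ) (x t : ℝ) : ℝ := sSup (maxSet f φ x t)

/-- The Hopf–Lax functional parametrised by the velocity variable `u`, where `d` plays the role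
of `f'` and `Φ` of a primitive of the initial datum. -/
def hopfLax (f d Φ : ℝ → ℝ) (x t u : ℝ) : ℝ :=
  Φ (x - t * d u) + t * (u * d u - f u)

def minimizers (f d Φ : ℝ → ℝ) (x t : ℝ) : Set ℝ :=
  {w | ∀ v, hopfLax f d Φ x t w ≤ hopfLax f d Φ x t v}

section HopfLax

variable {f d Φ : ℝ → ℝ} {M : ℝ}

lemma strictMono_of_tangent_lt (hT : ∀ a b, a ≠ b → f a + d a * (b - a) < f b) :
    StrictMono d := by
  intro a b hab
  have h1 := hT a b hab.ne
  have h2 := hT b a hab.ne'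
  by_contra! h
  nlinarith

lemma legendre_tangent_lt (hT : ∀ a b, a ≠ b → f a + d a * (b - a) < f b) {u a : ℝ}
    (h : a ≠ u) : (u * d u - f u) + u * (d a - d u) < a * d a - f a := by
  have := hT a u h
  linarith

lemma legendre_tangent_le (hT : ∀ a b, a ≠ b → f a + d a * (b - a) < f b) (u a : ℝ) :
    (u * d u - f u) + u * (d a - d u) ≤ a * d a - f a := by
  rcases eq_or_ne a u with rfl | h
  · simp
  · exact (legendre_tangent_lt hT h).le

lemma exists_eq_of_between (hc : Continuous d) {a b q : ℝ} (ha : d a ≤ q) (hb : q ≤ d b) :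
    ∃ c, d c = q :=
  mem_range_of_exists_le_of_exists_ge hc ⟨a, ha⟩ ⟨b, hb⟩

/-- A minimizer propagates down its characteristic, along which it is the only minimizer. -/
lemma hopfLax_lt_of_characteristic (hT : ∀ a b, a ≠ b → f a + d a * (b - a) < f b)
    (hc : Continuous d) {x s t w v : ℝ} (ht : 0 < t) (hts : t < s)
    (hw : w ∈ minimizers f d Φ x s) (hvw : v ≠ w) :
    hopfLax f d Φ (x - (s - t) * d w) t w < hopfLax f d Φ (x - (s - t) * d w) t v := by
  have hs : 0 < s := ht.trans hts
  obtain ⟨u, hu⟩ : ∃ u, d u = ((s - t) * d w + t * d v) / s := by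
    rcases le_total (d w) (d v) with h | h
    · refine exists_eq_of_between hc (a := w) (b := v) ?_ ?_
      · rw [le_div_iff₀ hs]; nlinarith
      · rw [div_le_iff₀ hs]; nlinarith
    · refine exists_eq_of_between hc (a := v) (b := w) ?_ ?_
      · rw [le_div_iff₀ hs]; nlinarith
      · rw [div_le_iff₀ hs]; nlinarith
  have hu' : s * d u = (s - t) * d w + t * d v := by rw [hu]; field_simp
  have hmin := hw u
  have hconv : s * (u * d u - f u) <
      (s - t) * (w * d w - f w) + t * (v * d v - f v) := by
    have hw' := legendre_tangent_le hT u w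
    have hv' := legendre_tangent_le hT u v
    have hst : 0 < s - t := sub_pos.2 hts
    have hid : (s - t) * (u * (d w - d u)) + t * (u * (d v - d u)) = 0 := by
      linear_combination (-u) * hu'
    rcases eq_or_ne v u with hvu | hvu
    · have hw'' := legendre_tangent_lt hT (u := u) (a := w) (by rintro rfl; exact hvw hvu)
      nlinarith
    · have hv'' := legendre_tangent_lt hT hvu
      nlinarith
  unfold hopfLax at hmin ⊢
  rw [show x - s * d u = x - (s - t) * d w - t * d v by linarith,
    show x - s * d w = x - (s - t) * d w - t * d w by ring] at hmin
  linarith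

lemma mem_minimizers_characteristic (hT : ∀ a b, a ≠ b → f a + d a * (b - a) < f b)
    (hc : Continuous d) {x s t w : ℝ} (ht : 0 < t) (hts : t < s)
    (hw : w ∈ minimizers f d Φ x s) : w ∈ minimizers f d Φ (x - (s - t) * d w) t := by
  intro v
  rcases eq_or_ne v w with rfl | h
  · exact le_rfl
  · exact (hopfLax_lt_of_characteristic hT hc ht hts hw h).le

lemma subsingleton_minimizers_characteristic (hT : ∀ a b, a ≠ b → f a + d a * (b - a) < f b)
    (hc : Continuous d) {x s t w : ℝ} (ht : 0 < t) (hts : t < s)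
    (hw : w ∈ minimizers f d Φ x s) :
    (minimizers f d Φ (x - (s - t) * d w) t).Subsingleton := by
  have key : ∀ v ∈ minimizers f d Φ (x - (s - t) * d w) t, v = w := by
    intro v hv
    by_contra h
    exact (hopfLax_lt_of_characteristic hT hc ht hts hw h).not_ge (hv w)
  intro v hv u hu
  exact (key v hv).trans (key u hu).symm

/-- The feet at time zero of backward characteristics are ordered. -/
lemma foot_le_foot (hT : ∀ a b, a ≠ b → f a + d a * (b - a) < f b)
    (hc : Continuous d) {x₁ x₂ t w₁ w₂ : ℝ} (ht : 0 < t) (hx : x₁ < x₂)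
    (h₁ : w₁ ∈ minimizers f d Φ x₁ t) (h₂ : w₂ ∈ minimizers f d Φ x₂ t) :
    x₁ - t * d w₁ ≤ x₂ - t * d w₂ := by
  by_contra! h
  obtain ⟨a, ha⟩ : ∃ a, d a = (x₁ - x₂ + t * d w₂) / t := by
    refine exists_eq_of_between hc (a := w₁) (b := w₂) ?_ ?_
    · rw [le_div_iff₀ ht]; nlinarith
    · rw [div_le_iff₀ ht]; nlinarith
  obtain ⟨b, hb⟩ : ∃ b, d b = (x₂ - x₁ + t * d w₁) / t := by
    refine exists_eq_of_between hc (a := w₁) (b := w₂) ?_ ?_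
    · rw [le_div_iff₀ ht]; nlinarith
    · rw [div_le_iff₀ ht]; nlinarith
  have ha' : t * d a = x₁ - x₂ + t * d w₂ := by rw [ha]; field_simp
  have hb' : t * d b = x₂ - x₁ + t * d w₁ := by rw [hb]; field_simp
  have e₁ := h₁ a
  have e₂ := h₂ b
  unfold hopfLax at e₁ e₂
  rw [show x₁ - t * d a = x₂ - t * d w₂ by linarith] at e₁
  rw [show x₂ - t * d b = x₁ - t * d w₁ by linarith] at e₂
  have hsum : t * ((w₁ * d w₁ - f w₁) + (w₂ * d w₂ - f w₂)) ≤
      t * ((a * d a - f a) + (b * d b - f b)) := by linarith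
  have hsum' := le_of_mul_le_mul_left hsum ht
  have hmono := (strictMono_of_tangent_lt hT)
  have hlt : d w₁ < d a := by
    refine lt_of_mul_lt_mul_left ?_ ht.le
    linarith
  have hlt' : d w₁ < d b := by
    refine lt_of_mul_lt_mul_left ?_ ht.le
    linarith
  have hs : d a + d b = d w₁ + d w₂ := by
    refine mul_left_cancel₀ ht.ne' ?_
    linarith
  have na : w₁ ≠ a := by rintro rfl; exact lt_irrefl _ hlt
  have nb : w₁ ≠ b := by rintro rfl; exact lt_irrefl _ hlt'
  rcases le_total a b with hab | hab
  · have i₁ := legendre_tangent_lt hT na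
    have i₂ := legendre_tangent_le hT b w₂
    have : d w₂ - d b = d a - d w₁ := by linarith
    rw [this] at i₂
    nlinarith
  · have i₁ := legendre_tangent_lt hT nb
    have i₂ := legendre_tangent_le hT a w₂
    have : d w₂ - d a = d b - d w₁ := by linarith
    rw [this] at i₂
    nlinarith

lemma hopfLax_lt_of_gt (hT : ∀ a b, a ≠ b → f a + d a * (b - a) < f b)
    (hΦ : ∀ y z, |Φ y - Φ z| ≤ M * |y - z|) {x t v : ℝ} (ht : 0 < t) (hv : M < v) :
    hopfLax f d Φ x t M < hopfLax f d Φ x t v := by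
  have h := legendre_tangent_lt hT hv.ne'
  have hd := strictMono_of_tangent_lt hT hv
  have h1 := (abs_le.1 (hΦ (x - t * d M) (x - t * d v))).2
  rw [show x - t * d M - (x - t * d v) = t * (d v - d M) by ring,
    abs_of_pos (mul_pos ht (sub_pos.2 hd))] at h1
  unfold hopfLax
  nlinarith

lemma hopfLax_lt_of_lt (hT : ∀ a b, a ≠ b → f a + d a * (b - a) < f b)
    (hΦ : ∀ y z, |Φ y - Φ z| ≤ M * |y - z|) {x t v : ℝ} (ht : 0 < t) (hv : v < -M) :
    hopfLax f d Φ x t (-M) < hopfLax f d Φ x t v := by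
  have h := legendre_tangent_lt hT hv.ne
  have hd := strictMono_of_tangent_lt hT hv
  have h1 := (abs_le.1 (hΦ (x - t * d (-M)) (x - t * d v))).2
  rw [show x - t * d (-M) - (x - t * d v) = -(t * (d (-M) - d v)) by ring, abs_neg,
    abs_of_pos (mul_pos ht (sub_pos.2 hd))] at h1
  unfold hopfLax
  nlinarith

lemma minimizers_subset_Icc (hT : ∀ a b, a ≠ b → f a + d a * (b - a) < f b)
    (hΦ : ∀ y z, |Φ y - Φ z| ≤ M * |y - z|) {x t : ℝ} (ht : 0 < t) :
    minimizers f d Φ x t ⊆ Icc (-M) M := by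
  intro w hw
  constructor
  · by_contra! h
    exact (hopfLax_lt_of_lt hT hΦ ht h).not_ge (hw _)
  · by_contra! h
    exact (hopfLax_lt_of_gt hT hΦ ht h).not_ge (hw _)

lemma continuous_of_abs_sub_le (hΦ : ∀ y z, |Φ y - Φ z| ≤ M * |y - z|) : Continuous Φ := by
  refine (LipschitzWith.of_dist_le_mul (K := M.toNNReal) fun y z => ?_).continuous
  rw [Real.dist_eq, Real.dist_eq]
  exact (hΦ y z).trans (mul_le_mul_of_nonneg_right (Real.le_coe_toNNReal M) (abs_nonneg _))

lemma nonempty_minimizers (hT : ∀ a b, a ≠ b → f a + d a * (b - a) < f b)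
    (hf : Continuous f) (hc : Continuous d) (hM : 0 ≤ M)
    (hΦ : ∀ y z, |Φ y - Φ z| ≤ M * |y - z|) {x t : ℝ} (ht : 0 < t) :
    (minimizers f d Φ x t).Nonempty := by
  have hΦc := continuous_of_abs_sub_le hΦ
  have hcont : Continuous (hopfLax f d Φ x t) := by unfold hopfLax; fun_prop
  have hne : (Icc (-M) M).Nonempty := nonempty_Icc.2 (by linarith)
  obtain ⟨w, -, hw⟩ := isCompact_Icc.exists_isMinOn hne hcont.continuousOn
  refine ⟨w, fun v => ?_⟩
  rcases lt_or_ge v (-M) with h | h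
  · exact (hw ⟨le_rfl, by linarith⟩).trans (hopfLax_lt_of_lt hT hΦ ht h).le
  rcases lt_or_ge M v with h' | h'
  · exact (hw ⟨by linarith, le_rfl⟩).trans (hopfLax_lt_of_gt hT hΦ ht h').le
  · exact hw ⟨h, h'⟩

lemma isClosed_exists_minimizer (hT : ∀ a b, a ≠ b → f a + d a * (b - a) < f b)
    (hf : Continuous f) (hc : Continuous d)
    (hΦ : ∀ y z, |Φ y - Φ z| ≤ M * |y - z|) {t : ℝ} (ht : 0 < t) {C : Set (ℝ × ℝ)}
    (hC : IsClosed C) :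
    IsClosed {x | ∃ w ∈ minimizers f d Φ x t, (x, w) ∈ C} := by
  have hΦc := continuous_of_abs_sub_le hΦ
  let D : Set (ℝ × Icc (-M) M) :=
    {p | (p.2 : ℝ) ∈ minimizers f d Φ p.1 t} ∩ {p | (p.1, (p.2 : ℝ)) ∈ C}
  have hD : IsClosed D := by
    refine IsClosed.inter ?_ (hC.preimage (by fun_prop))
    have heq : {p : ℝ × Icc (-M) M | (p.2 : ℝ) ∈ minimizers f d Φ p.1 t} =
        ⋂ v, {p | hopfLax f d Φ p.1 t p.2 ≤ hopfLax f d Φ p.1 t v} := by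
      ext p
      simp [minimizers]
    rw [heq]
    refine isClosed_iInter fun v => isClosed_le ?_ ?_ <;> unfold hopfLax <;> fun_prop
  convert isClosedMap_fst_of_compactSpace D hD using 1
  ext x
  constructor
  · rintro ⟨w, hw, hwC⟩
    exact ⟨(x, ⟨w, minimizers_subset_Icc hT hΦ ht hw⟩), ⟨hw, hwC⟩, rfl⟩
  · rintro ⟨⟨y, w⟩, ⟨hw, hwC⟩, rfl⟩
    exact ⟨w, hw, hwC⟩

lemma isClosed_minimizers (hf : Continuous f) (hc : Continuous d)
    (hΦ : ∀ y z, |Φ y - Φ z| ≤ M * |y - z|) (x t : ℝ) :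
    IsClosed (minimizers f d Φ x t) := by
  have hΦc := continuous_of_abs_sub_le hΦ
  simp only [minimizers, ofPred_forall]
  refine isClosed_iInter fun v => isClosed_le ?_ ?_ <;> unfold hopfLax <;> fun_prop

/-- Some point at the later time `s` has backward characteristics passing on both sides
of a given point `(y, t)` at which minimizers are not unique. -/
lemma exists_straddling_point (hT : ∀ a b, a ≠ b → f a + d a * (b - a) < f b)
    (hf : Continuous f) (hc : Continuous d) (hM : 0 ≤ M)
    (hΦ : ∀ y z, |Φ y - Φ z| ≤ M * |y - z|) {y s t : ℝ} (ht : 0 < t) (hts : t < s)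
    (hy : ¬ (minimizers f d Φ y t).Subsingleton) :
    ∃ ξ, ∃ p ∈ minimizers f d Φ ξ s, ∃ q ∈ minimizers f d Φ ξ s,
      ξ - (s - t) * d p < y ∧ y < ξ - (s - t) * d q := by
  have hs := ht.trans hts
  have hne : ∀ ξ, ∀ w ∈ minimizers f d Φ ξ s, ξ - (s - t) * d w ≠ y := by
    rintro ξ w hw rfl
    exact hy (subsingleton_minimizers_characteristic hT hc ht hts hw)
  have hL : IsClosed {ξ | ∃ w ∈ minimizers f d Φ ξ s,
      (ξ, w) ∈ {p : ℝ × ℝ | p.1 - (s - t) * d p.2 ≤ y}} :=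
    isClosed_exists_minimizer hT hf hc hΦ hs (isClosed_le (by fun_prop) (by fun_prop))
  have hR : IsClosed {ξ | ∃ w ∈ minimizers f d Φ ξ s,
      (ξ, w) ∈ {p : ℝ × ℝ | y ≤ p.1 - (s - t) * d p.2}} :=
    isClosed_exists_minimizer hT hf hc hΦ hs (isClosed_le (by fun_prop) (by fun_prop))
  have hmono := (strictMono_of_tangent_lt hT).monotone
  have hnonempty : ∀ ξ, (minimizers f d Φ ξ s).Nonempty :=
    fun ξ => nonempty_minimizers hT hf hc hM hΦ hs
  have hbd : ∀ ξ, ∀ w ∈ minimizers f d Φ ξ s, d (-M) ≤ d w ∧ d w ≤ d M := fun ξ w hw =>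
    ⟨hmono (minimizers_subset_Icc hT hΦ hs hw).1, hmono (minimizers_subset_Icc hT hΦ hs hw).2⟩
  have hst : 0 < s - t := sub_pos.2 hts
  obtain ⟨ξ, -, ⟨p, hp, hpy⟩, ⟨q, hq, hqy⟩⟩ :=
    isPreconnected_closed_iff.1 (isPreconnected_univ (α := ℝ)) _ _ hL hR
      (by
        intro ξ _
        obtain ⟨w, hw⟩ := hnonempty ξ
        rcases le_total (ξ - (s - t) * d w) y with h | h
        · exact Or.inl ⟨w, hw, h⟩
        · exact Or.inr ⟨w, hw, h⟩)
      (by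
        obtain ⟨w, hw⟩ := hnonempty (y + (s - t) * d (-M))
        refine ⟨_, mem_univ _, w, hw, ?_⟩
        have := (hbd _ w hw).1
        simp only [mem_ofPred_eq]
        nlinarith)
      (by
        obtain ⟨w, hw⟩ := hnonempty (y + (s - t) * d M)
        refine ⟨_, mem_univ _, w, hw, ?_⟩
        have := (hbd _ w hw).2
        simp only [mem_ofPred_eq]
        nlinarith)
  exact ⟨ξ, p, hp, q, hq, lt_of_le_of_ne hpy (hne ξ p hp), lt_of_le_of_ne hqy (hne ξ q hq).symm⟩

/-- The triangle of backward characteristics from a later point of a discontinuity curve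
encloses its earlier points. -/
lemma exists_minimizers_straddling_curve (hT : ∀ a b, a ≠ b → f a + d a * (b - a) < f b)
    (hf : Continuous f) (hc : Continuous d) (hM : 0 ≤ M)
    (hΦ : ∀ y z, |Φ y - Φ z| ≤ M * |y - z|) {x : ℝ → ℝ} {s t : ℝ} (ht : 0 < t) (hts : t < s)
    (hx : ContinuousOn x (Icc t s))
    (hjump : ∀ τ ∈ Ico t s, ¬ (minimizers f d Φ (x τ) τ).Subsingleton) :
    ∃ p ∈ minimizers f d Φ (x s) s, ∃ q ∈ minimizers f d Φ (x s) s,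
      x s - (s - t) * d p < x t ∧ x t < x s - (s - t) * d q := by
  obtain ⟨ξ, p, hp, q, hq, hpt, hqt⟩ :=
    exists_straddling_point hT hf hc hM hΦ ht hts (hjump t ⟨le_rfl, hts⟩)
  have hne : ∀ w ∈ minimizers f d Φ ξ s, ∀ τ ∈ Icc t s, x s ≠ ξ →
      x τ - (ξ - (s - τ) * d w) ≠ 0 := by
    intro w hw τ hτ hs h
    rcases hτ.2.eq_or_lt with rfl | hlt
    · apply hs; linarith
    · apply hjump τ ⟨hτ.1, hlt⟩
      rw [sub_eq_zero.1 h]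
      exact subsingleton_minimizers_characteristic hT hc (ht.trans_le hτ.1) hlt hw
  have hcont : ∀ w, ContinuousOn (fun τ => x τ - (ξ - (s - τ) * d w)) (Icc t s) :=
    fun w => hx.sub (by fun_prop)
  have hξ : x s = ξ := by
    rcases lt_trichotomy (x s) ξ with h | h | h
    · obtain ⟨τ, hτ, h0⟩ := intermediate_value_Icc' hts.le (hcont p)
        (show (0 : ℝ) ∈ Icc _ _ from ⟨by linarith, by linarith⟩)
      exact absurd h0 (hne p hp τ hτ h.ne)
    · exact h
    · obtain ⟨τ, hτ, h0⟩ := intermediate_value_Icc hts.le (hcont q)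
        (show (0 : ℝ) ∈ Icc _ _ from ⟨by linarith, by linarith⟩)
      exact absurd h0 (hne q hq τ hτ h.ne')
  subst hξ
  exact ⟨p, hp, q, hq, hpt, hqt⟩

lemma tendsto_minimizer_of_lt {ι : Type*} {l : Filter ι} {X p : ι → ℝ} {x t a : ℝ}
    (hT : ∀ a b, a ≠ b → f a + d a * (b - a) < f b)
    (hf : Continuous f) (hc : Continuous d)
    (hΦ : ∀ y z, |Φ y - Φ z| ≤ M * |y - z|) (ht : 0 < t)
    (ha : IsGreatest (minimizers f d Φ x t) a) (hX : Tendsto X l (nhds x))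
    (hp : ∀ᶠ i in l, p i ∈ minimizers f d Φ (X i) t) (hlt : ∀ᶠ i in l, X i < x) :
    Tendsto p l (nhds a) := by
  have hd := strictMono_of_tangent_lt hT
  refine tendsto_order.2 ⟨fun b hb => ?_, fun b hb => ?_⟩
  · have h1 : x - t * (d a - d b) < x := by nlinarith [hd hb]
    filter_upwards [hX.eventually (lt_mem_nhds h1), hp, hlt] with i h2 h3 h4
    have h5 := foot_le_foot hT hc ht h4 h3 ha.1
    exact hd.lt_iff_lt.1 (lt_of_mul_lt_mul_left (a := t) (by linarith) ht.le)
  · have hcl : IsClosed {y | ∃ w ∈ minimizers f d Φ y t, (y, w) ∈ {r : ℝ × ℝ | b ≤ r.2}} :=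
      isClosed_exists_minimizer hT hf hc hΦ ht (isClosed_le (by fun_prop) (by fun_prop))
    have hx : x ∈ {y | ∃ w ∈ minimizers f d Φ y t, (y, w) ∈ {r : ℝ × ℝ | b ≤ r.2}}ᶜ := by
      rintro ⟨w, hw, hbw⟩
      exact absurd (ha.2 hw) (not_le.2 (hb.trans_le hbw))
    filter_upwards [hX.eventually (hcl.isOpen_compl.mem_nhds hx), hp] with i h2 h3
    by_contra! h
    exact h2 ⟨p i, h3, h⟩

lemma tendsto_minimizer_of_gt {ι : Type*} {l : Filter ι} {X p : ι → ℝ} {x t a : ℝ}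
    (hT : ∀ a b, a ≠ b → f a + d a * (b - a) < f b)
    (hf : Continuous f) (hc : Continuous d)
    (hΦ : ∀ y z, |Φ y - Φ z| ≤ M * |y - z|) (ht : 0 < t)
    (ha : IsLeast (minimizers f d Φ x t) a) (hX : Tendsto X l (nhds x))
    (hp : ∀ᶠ i in l, p i ∈ minimizers f d Φ (X i) t) (hgt : ∀ᶠ i in l, x < X i) :
    Tendsto p l (nhds a) := by
  have hd := strictMono_of_tangent_lt hT
  refine tendsto_order.2 ⟨fun b hb => ?_, fun b hb => ?_⟩
  · have hcl : IsClosed {y | ∃ w ∈ minimizers f d Φ y t, (y, w) ∈ {r : ℝ × ℝ | r.2 ≤ b}} :=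
      isClosed_exists_minimizer hT hf hc hΦ ht (isClosed_le (by fun_prop) (by fun_prop))
    have hx : x ∈ {y | ∃ w ∈ minimizers f d Φ y t, (y, w) ∈ {r : ℝ × ℝ | r.2 ≤ b}}ᶜ := by
      rintro ⟨w, hw, hbw⟩
      exact absurd (ha.2 hw) (not_le.2 (lt_of_le_of_lt hbw hb))
    filter_upwards [hX.eventually (hcl.isOpen_compl.mem_nhds hx), hp] with i h2 h3
    by_contra! h
    exact h2 ⟨p i, h3, h⟩
  · have h1 : x < x + t * (d b - d a) := by nlinarith [hd hb]
    filter_upwards [hX.eventually (gt_mem_nhds h1), hp, hgt] with i h2 h3 h4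
    have h5 := foot_le_foot hT hc ht h4 ha.1 h3
    exact hd.lt_iff_lt.1 (lt_of_mul_lt_mul_left (a := t) (by linarith) ht.le)

lemma hopfLax_le_add_mul (hT : ∀ a b, a ≠ b → f a + d a * (b - a) < f b)
    {x X t a p b : ℝ} (ht : 0 < t) (ha : a ∈ minimizers f d Φ x t)
    (hb : t * d b = x - X + t * d p) :
    hopfLax f d Φ x t a ≤ hopfLax f d Φ X t p + b * (x - X) := by
  have h := ha b
  have hg := mul_le_mul_of_nonneg_left (legendre_tangent_le hT b p) ht.le
  unfold hopfLax at h ⊢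
  rw [show x - t * d b = X - t * d p by linarith] at h
  have hid : t * (b * (d p - d b)) = - (b * (x - X)) := by linear_combination (-b) * hb
  linarith

/-- The value function is differentiable in space, with derivative `a`, along any family of
minimizers converging to the minimizer `a`. -/
lemma eventually_abs_hopfLax_sub_le {ι : Type*} {l : Filter ι} {X p : ι → ℝ} {x t a : ℝ}
    (hT : ∀ a b, a ≠ b → f a + d a * (b - a) < f b) (hc : Continuous d) (ht : 0 < t)
    (ha : a ∈ minimizers f d Φ x t) (hX : Tendsto X l (nhds x))
    (hp : ∀ᶠ i in l, p i ∈ minimizers f d Φ (X i) t) (hpa : Tendsto p l (nhds a))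
    {ε : ℝ} (hε : 0 < ε) :
    ∀ᶠ i in l, |hopfLax f d Φ (X i) t (p i) - hopfLax f d Φ x t a - a * (X i - x)|
      ≤ ε * |X i - x| := by
  have hd := strictMono_of_tangent_lt hT
  have hlo : t * d (a - ε) < t * d a := mul_lt_mul_of_pos_left (hd (by linarith)) ht
  have hhi : t * d a < t * d (a + ε) := mul_lt_mul_of_pos_left (hd (by linarith)) ht
  have hb : Tendsto (fun i => x - X i + t * d (p i)) l (nhds (t * d a)) := by
    have := (hX.const_sub x).add (((hc.tendsto a).comp hpa).const_mul t)
    simpa using this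
  have hc' : Tendsto (fun i => X i - x + t * d a) l (nhds (t * d a)) := by
    have := (hX.sub_const x).add_const (t * d a)
    simpa using this
  have hex : ∀ q, t * d (a - ε) < q → q < t * d (a + ε) →
      ∃ b, t * d b = q ∧ |b - a| < ε := by
    intro q h1 h2
    obtain ⟨b, hb⟩ := exists_eq_of_between hc (a := a - ε) (b := a + ε) (q := q / t)
      (by rw [le_div_iff₀ ht]; linarith) (by rw [div_le_iff₀ ht]; linarith)
    have hb' : t * d b = q := by rw [hb]; field_simp
    refine ⟨b, hb', abs_sub_lt_iff.2 ⟨?_, ?_⟩⟩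
    · have := hd.lt_iff_lt.1 (lt_of_mul_lt_mul_left (a := t) (hb'.trans_lt h2) ht.le)
      linarith
    · have := hd.lt_iff_lt.1 (lt_of_mul_lt_mul_left (a := t) (h1.trans_eq hb'.symm) ht.le)
      linarith
  filter_upwards [hp, hb.eventually (lt_mem_nhds hlo), hb.eventually (gt_mem_nhds hhi),
    hc'.eventually (lt_mem_nhds hlo), hc'.eventually (gt_mem_nhds hhi)] with i hpi h1 h2 h3 h4
  obtain ⟨b, hbq, hba⟩ := hex _ h1 h2
  obtain ⟨c, hcq, hca⟩ := hex _ h3 h4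
  have e1 := hopfLax_le_add_mul hT ht ha hbq
  have e2 := hopfLax_le_add_mul hT ht hpi hcq
  have f1 : |(b - a) * (X i - x)| ≤ ε * |X i - x| := by
    rw [abs_mul]; exact mul_le_mul_of_nonneg_right hba.le (abs_nonneg _)
  have f2 : |(c - a) * (X i - x)| ≤ ε * |X i - x| := by
    rw [abs_mul]; exact mul_le_mul_of_nonneg_right hca.le (abs_nonneg _)
  rw [abs_le] at f1 f2 ⊢
  constructor <;> linarith [f1.1, f2.2]

lemma hopfLax_add_time (x t h w : ℝ) :
    hopfLax f d Φ x (t + h) w =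
      hopfLax f d Φ (x - h * d w) t w + h * (w * d w - f w) := by
  unfold hopfLax
  rw [show x - (t + h) * d w = x - h * d w - t * d w by ring]
  ring

theorem tendsto_slope_of_discontinuity_curve
    (hT : ∀ a b, a ≠ b → f a + d a * (b - a) < f b)
    (hf : Continuous f) (hc : Continuous d) (hM : 0 ≤ M)
    (hΦ : ∀ y z, |Φ y - Φ z| ≤ M * |y - z|) {x : ℝ → ℝ} {t a b : ℝ} (ht : 0 < t)
    (hx : ContinuousOn x (Ici t))
    (hjump : ∀ τ ∈ Ici t, ¬ (minimizers f d Φ (x τ) τ).Subsingleton)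
    (ha : IsGreatest (minimizers f d Φ (x t) t) a)
    (hb : IsLeast (minimizers f d Φ (x t) t) b) (hba : b < a) :
    Tendsto (fun h : ℝ => (x (t + h) - x t) / h) (nhdsWithin 0 (Ioi 0))
      (nhds ((f a - f b) / (a - b))) := by
  have hmono := (strictMono_of_tangent_lt hT).monotone
  have hex : ∀ h : ℝ, ∃ p q, 0 < h → p ∈ minimizers f d Φ (x (t + h)) (t + h) ∧
      q ∈ minimizers f d Φ (x (t + h)) (t + h) ∧
      x (t + h) - h * d p < x t ∧ x t < x (t + h) - h * d q := by
    intro h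
    by_cases hh : 0 < h
    · obtain ⟨p, hp, q, hq, h1, h2⟩ := exists_minimizers_straddling_curve hT hf hc hM hΦ ht
        (lt_add_of_pos_right t hh) (hx.mono Icc_subset_Ici_self)
        (fun τ hτ => hjump τ hτ.1)
      rw [add_sub_cancel_left] at h1 h2
      exact ⟨p, q, fun _ => ⟨hp, hq, h1, h2⟩⟩
    · exact ⟨0, 0, fun h => absurd h hh⟩
  choose p q hpq using hex
  have hpos : ∀ᶠ h : ℝ in nhdsWithin 0 (Ioi 0), 0 < h := self_mem_nhdsWithin
  have hxt : Tendsto (fun h => x (t + h)) (nhdsWithin 0 (Ioi 0)) (nhds (x t)) := by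
    refine (hx t self_mem_Ici).tendsto.comp (tendsto_nhdsWithin_iff.2 ⟨?_, ?_⟩)
    · have : Tendsto (fun h : ℝ => t + h) (nhds 0) (nhds (t + 0)) :=
        tendsto_const_nhds.add tendsto_id
      rw [add_zero] at this
      exact this.mono_left nhdsWithin_le_nhds
    · filter_upwards [hpos] with h hh
      simpa using hh.le
  have hfoot : ∀ w : ℝ → ℝ, (∀ h, 0 < h → w h ∈ minimizers f d Φ (x (t + h)) (t + h)) →
      Tendsto (fun h => x (t + h) - h * d (w h)) (nhdsWithin 0 (Ioi 0)) (nhds (x t)) := by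
    intro w hw
    have h0 : Tendsto (fun h : ℝ => h) (nhdsWithin 0 (Ioi 0)) (nhds 0) :=
      tendsto_id.mono_left nhdsWithin_le_nhds
    have h1 : Tendsto (fun h => h * d (w h)) (nhdsWithin 0 (Ioi 0)) (nhds 0) := by
      refine tendsto_of_tendsto_of_tendsto_of_le_of_le' (g := fun h => h * d (-M))
        (h := fun h => h * d M) (by simpa using h0.mul_const (d (-M)))
        (by simpa using h0.mul_const (d M)) ?_ ?_
      · filter_upwards [hpos] with h hh
        exact mul_le_mul_of_nonneg_left
          (hmono (minimizers_subset_Icc hT hΦ (by linarith) (hw h hh)).1) hh.le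
      · filter_upwards [hpos] with h hh
        exact mul_le_mul_of_nonneg_left
          (hmono (minimizers_subset_Icc hT hΦ (by linarith) (hw h hh)).2) hh.le
    simpa using hxt.sub h1
  have hXp := hfoot p fun h hh => (hpq h hh).1
  have hXq := hfoot q fun h hh => (hpq h hh).2.1
  have hback : ∀ h, 0 < h → ∀ w ∈ minimizers f d Φ (x (t + h)) (t + h),
      w ∈ minimizers f d Φ (x (t + h) - h * d w) t := by
    intro h hh w hw
    have := mem_minimizers_characteristic hT hc ht (lt_add_of_pos_right t hh) hw
    rwa [add_sub_cancel_left] at this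
  have hp : ∀ᶠ h in nhdsWithin 0 (Ioi 0),
      p h ∈ minimizers f d Φ (x (t + h) - h * d (p h)) t := by
    filter_upwards [hpos] with h hh using hback h hh _ (hpq h hh).1
  have hq : ∀ᶠ h in nhdsWithin 0 (Ioi 0),
      q h ∈ minimizers f d Φ (x (t + h) - h * d (q h)) t := by
    filter_upwards [hpos] with h hh using hback h hh _ (hpq h hh).2.1
  have hpa : Tendsto p (nhdsWithin 0 (Ioi 0)) (nhds a) :=
    tendsto_minimizer_of_lt hT hf hc hΦ ht ha hXp hp
      (by filter_upwards [hpos] with h hh using (hpq h hh).2.2.1)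
  have hqb : Tendsto q (nhdsWithin 0 (Ioi 0)) (nhds b) :=
    tendsto_minimizer_of_gt hT hf hc hΦ ht hb hXq hq
      (by filter_upwards [hpos] with h hh using (hpq h hh).2.2.2)
  let A : ℝ → ℝ := fun h =>
    a * d (p h) - b * d (q h) - (p h * d (p h) - f (p h)) + (q h * d (q h) - f (q h))
  have hA : Tendsto A (nhdsWithin 0 (Ioi 0)) (nhds (f a - f b)) := by
    have hdp := (hc.tendsto a).comp hpa
    have hdq := (hc.tendsto b).comp hqb
    have hfp := (hf.tendsto a).comp hpa
    have hfq := (hf.tendsto b).comp hqb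
    have := (((hdp.const_mul a).sub (hdq.const_mul b)).sub ((hpa.mul hdp).sub hfp)).add
      ((hqb.mul hdq).sub hfq)
    rw [show f a - f b = a * d a - b * d b - (a * d a - f a) + (b * d b - f b) by ring]
    exact this
  have hdiff : Tendsto (fun h => (x (t + h) - x t) / h * (a - b) - A h)
      (nhdsWithin 0 (Ioi 0)) (nhds 0) := by
    rw [Metric.tendsto_nhds]
    intro ε hε
    have hD : 0 ≤ d M - d (-M) := sub_nonneg.2 (hmono (by linarith))
    have hε' : 0 < ε / (d M - d (-M) + 1) := by positivity
    have hεD : ε / (d M - d (-M) + 1) * (d M - d (-M)) < ε := by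
      rw [div_mul_eq_mul_div, div_lt_iff₀ (by linarith)]
      nlinarith
    generalize ε / (d M - d (-M) + 1) = δ at hε' hεD
    filter_upwards [hpos, eventually_abs_hopfLax_sub_le hT hc ht ha.1 hXp hp hpa hε',
      eventually_abs_hopfLax_sub_le hT hc ht hb.1 hXq hq hqb hε'] with h hh h1 h2
    obtain ⟨m1, m2, l1, l2⟩ := hpq h hh
    have heq : hopfLax f d Φ (x (t + h)) (t + h) (p h)
        = hopfLax f d Φ (x (t + h)) (t + h) (q h) := le_antisymm (m1 _) (m2 _)
    rw [hopfLax_add_time, hopfLax_add_time] at heq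
    have heq' : hopfLax f d Φ (x t) t a = hopfLax f d Φ (x t) t b :=
      le_antisymm (ha.1 _) (hb.1 _)
    have hb1 : d (p h) ≤ d M := hmono (minimizers_subset_Icc hT hΦ (by linarith) m1).2
    have hb2 : d (-M) ≤ d (q h) := hmono (minimizers_subset_Icc hT hΦ (by linarith) m2).1
    rw [abs_of_neg (sub_neg.2 l1)] at h1
    rw [abs_of_pos (sub_pos.2 l2)] at h2
    have hσ : x (t + h) - x t = h * ((x (t + h) - x t) / h) := by field_simp
    generalize (x (t + h) - x t) / h = σ at hσ ⊢
    have hkey : |h * (σ * (a - b) - A h)| ≤ h * (δ * (d (p h) - d (q h))) := by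
      have e1 : x (t + h) - h * d (p h) - x t = h * (σ - d (p h)) := by linarith
      have e2 : x (t + h) - h * d (q h) - x t = h * (σ - d (q h)) := by linarith
      rw [e1] at h1
      rw [e2] at h2
      rw [abs_le] at h1 h2 ⊢
      simp only [A]
      constructor <;> linarith [h1.1, h1.2, h2.1, h2.2]
    rw [abs_mul, abs_of_pos hh] at hkey
    have hkey' := le_of_mul_le_mul_left hkey hh
    rw [Real.dist_eq, sub_zero]
    refine hkey'.trans_lt (lt_of_le_of_lt ?_ hεD)
    exact mul_le_mul_of_nonneg_left (by linarith) hε'.le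
  have hsum := (hdiff.add hA).div_const (a - b)
  have hab : a - b ≠ 0 := (sub_pos.2 hba).ne'
  simp only [zero_add] at hsum
  refine hsum.congr fun h => ?_
  rw [sub_add_cancel, mul_div_cancel_right₀ _ hab]

end HopfLax

lemma strictMono_deriv_of_ae_pos {f : ℝ → ℝ} (hf : ContDiff ℝ 2 f)
    (hconv : ∀ u, 0 ≤ deriv (deriv f) u)
    (hdeg : volume {u : ℝ | deriv (deriv f) u = 0} = 0) : StrictMono (deriv f) := by
  have hd : Differentiable ℝ (deriv f) := hf.differentiable_deriv_two
  have hmono : Monotone (deriv f) := monotone_of_deriv_nonneg hd hconv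
  intro a b hab
  refine lt_of_le_of_ne (hmono hab.le) fun heq => ?_
  have hsub : Ioo a b ⊆ {u : ℝ | deriv (deriv f) u = 0} := by
    intro u hu
    have hev : deriv f =ᶠ[nhds u] fun _ => deriv f a := by
      filter_upwards [Ioo_mem_nhds hu.1 hu.2] with v hv
      exact le_antisymm ((hmono hv.2.le).trans heq.ge) (hmono hv.1.le)
    rw [mem_ofPred_eq, hev.deriv_eq, deriv_const]
  have := measure_mono_null hsub hdeg
  rw [Real.volume_Ioo, ENNReal.ofReal_eq_zero] at this
  linarith

lemma tangent_lt_of_strictMono_deriv {f : ℝ → ℝ} (hf : Differentiable ℝ f)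
    (hd : StrictMono (deriv f)) (a b : ℝ) (hab : a ≠ b) :
    f a + deriv f a * (b - a) < f b := by
  rcases hab.lt_or_gt with h | h
  · obtain ⟨c, hc, hc'⟩ := exists_deriv_eq_slope f h hf.continuous.continuousOn
      hf.differentiableOn
    rw [eq_div_iff (sub_pos.2 h).ne'] at hc'
    nlinarith [hd hc.1]
  · obtain ⟨c, hc, hc'⟩ := exists_deriv_eq_slope f h hf.continuous.continuousOn
      hf.differentiableOn
    rw [eq_div_iff (sub_pos.2 h).ne'] at hc'
    nlinarith [hd hc.2]

lemma intervalIntegrable_of_abs_le {φ : ℝ → ℝ} {M : ℝ} (hφ : Measurable φ)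
    (hb : ∀ x, |φ x| ≤ M) (a b : ℝ) : IntervalIntegrable φ volume a b :=
  (intervalIntegrable_const (c := M)).mono_fun hφ.aestronglyMeasurable
    (ae_of_all _ fun x => by
      simpa [Real.norm_eq_abs] using (hb x).trans (le_abs_self M))

lemma abs_primitive_sub_le {φ : ℝ → ℝ} {M : ℝ} (hφ : Measurable φ) (hb : ∀ x, |φ x| ≤ M)
    (y z : ℝ) : |(∫ s in (0 : ℝ)..y, φ s) - ∫ s in (0 : ℝ)..z, φ s| ≤ M * |y - z| := by
  rw [intervalIntegral.integral_interval_sub_left (intervalIntegrable_of_abs_le hφ hb _ _)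
    (intervalIntegrable_of_abs_le hφ hb _ _)]
  rw [← Real.norm_eq_abs]
  exact intervalIntegral.norm_integral_le_of_norm_le_const fun x _ => hb x

lemma eFun_eq_sub_hopfLax {f φ : ℝ → ℝ} {M : ℝ} (hf : ContDiff ℝ 2 f)
    (hconv : ∀ u, 0 ≤ deriv (deriv f) u) (hφ : Measurable φ) (hb : ∀ x, |φ x| ≤ M)
    {x t : ℝ} (ht : 0 < t) (u : ℝ) :
    eFun f φ u x t = hopfLax f (deriv f) (fun y => ∫ s in (0 : ℝ)..y, φ s) x t 0
      - hopfLax f (deriv f) (fun y => ∫ s in (0 : ℝ)..y, φ s) x t u := by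
  have hf1 : Differentiable ℝ f := hf.differentiable (by norm_num)
  have hd : Differentiable ℝ (deriv f) := hf.differentiable_deriv_two
  have hdd : Continuous (deriv (deriv f)) := by
    have : ContDiff ℝ 1 (deriv f) := (contDiff_succ_iff_deriv (n := 1).1 hf).2.2
    exact this.continuous_deriv le_rfl
  have hg : ∀ s, HasDerivAt (fun s => x - t * deriv f s) (-(t * deriv (deriv f) s)) s :=
    fun s => ((hd s).hasDerivAt.const_mul t).const_sub x
  have hcv := intervalIntegral.integral_deriv_smul_comp_of_deriv_nonpos
    (a := 0) (b := u) (f := fun s => x - t * deriv f s)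
    (f' := fun s => -(t * deriv (deriv f) s)) (g := φ)
    (by have := hd.continuous; fun_prop)
    (fun s _ => hg s) (fun s _ => neg_nonpos.2 (mul_nonneg ht.le (hconv s)))
  have hcv' : t * ∫ s in (0 : ℝ)..u, deriv (deriv f) s * φ (x - t * deriv f s) =
      (∫ s in (0 : ℝ)..(x - t * deriv f 0), φ s) - ∫ s in (0 : ℝ)..(x - t * deriv f u), φ s := by
    rw [intervalIntegral.integral_interval_sub_left (intervalIntegrable_of_abs_le hφ hb _ _)
      (intervalIntegrable_of_abs_le hφ hb _ _),
      intervalIntegral.integral_symm (x - t * deriv f 0), ← hcv,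
      ← intervalIntegral.integral_neg, ← intervalIntegral.integral_const_mul]
    congr 1
    ext s
    simp only [Function.comp, smul_eq_mul]
    ring
  have hleg : ∫ s in (0 : ℝ)..u, deriv (deriv f) s * s = u * deriv f u - f u + f 0 := by
    rw [intervalIntegral.integral_eq_sub_of_hasDerivAt (f := fun s => s * deriv f s - f s)]
    · ring
    · intro s _
      have h := ((hasDerivAt_id s).mul (hd s).hasDerivAt).sub (hf1 s).hasDerivAt
      rw [id, show 1 * deriv f s + s * deriv (deriv f) s - deriv f s
        = deriv (deriv f) s * s by ring] at h
      exact h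
    · exact (hdd.mul continuous_id).intervalIntegrable _ _
  have hint : IntervalIntegrable (fun s => deriv (deriv f) s * φ (x - t * deriv f s))
      volume 0 u := by
    refine (intervalIntegrable_of_abs_le (φ := fun s => φ (x - t * deriv f s))
      (hφ.comp ?_) (fun s => hb _) 0 u).continuousOn_mul hdd.continuousOn
    have := hd.continuous
    exact Continuous.measurable (by fun_prop)
  have hint' : IntervalIntegrable (fun s => deriv (deriv f) s * s) volume 0 u :=
    (hdd.mul continuous_id).intervalIntegrable _ _
  unfold eFun hopfLax
  rw [intervalIntegral.integral_congr fun s _ => mul_sub _ _ _,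
    intervalIntegral.integral_sub hint hint', mul_sub, hcv', hleg]
  ring

/-- any continuous curve of discontinuity is differentiable from the
right with Rankine–Hugoniot speed, which lies strictly between the characteristic
speeds. -/
theorem stmt17_rankine_hugoniot_right_derivative
    (f φ : ℝ → ℝ) (M : ℝ)
    (hf : ContDiff ℝ 2 f)
    (hconv : ∀ u : ℝ, 0 ≤ deriv (deriv f) u)
    (hdeg : volume {u : ℝ | deriv (deriv f) u = 0} = 0)
    (hφmeas : Measurable φ)
    (hφbdd : ∀ x : ℝ, |φ x| ≤ M)
    (t₀ : ℝ) (ht₀ : 0 ≤ t₀) (x : ℝ → ℝ)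
    (hxcont : ContinuousOn x (Set.Ioi t₀))
    (hjump : ∀ t : ℝ, t₀ < t → uPlus f φ (x t) t < uMinus f φ (x t) t) :
    ∀ t : ℝ, t₀ < t →
      Tendsto (fun h : ℝ => (x (t + h) - x t) / h) (nhdsWithin 0 (Set.Ioi 0))
        (nhds ((f (uMinus f φ (x t) t) - f (uPlus f φ (x t) t))
          / (uMinus f φ (x t) t - uPlus f φ (x t) t))) ∧
      deriv f (uPlus f φ (x t) t)
        < (f (uMinus f φ (x t) t) - f (uPlus f φ (x t) t))
            / (uMinus f φ (x t) t - uPlus f φ (x t) t) ∧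
      (f (uMinus f φ (x t) t) - f (uPlus f φ (x t) t))
            / (uMinus f φ (x t) t - uPlus f φ (x t) t)
        < deriv f (uMinus f φ (x t) t) := by
  have hf1 : Differentiable ℝ f := hf.differentiable (by norm_num)
  have hd : StrictMono (deriv f) := strictMono_deriv_of_ae_pos hf hconv hdeg
  have hc : Continuous (deriv f) := hf.differentiable_deriv_two.continuous
  have hT := tangent_lt_of_strictMono_deriv hf1 hd
  have hM : 0 ≤ M := (abs_nonneg _).trans (hφbdd 0)
  let Φ : ℝ → ℝ := fun y => ∫ s in (0 : ℝ)..y, φ s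
  have hΦ : ∀ y z, |Φ y - Φ z| ≤ M * |y - z| := abs_primitive_sub_le hφmeas hφbdd
  have hset : ∀ y s, 0 < s → maxSet f φ y s = minimizers f (deriv f) Φ y s := by
    intro y s hs
    ext w
    simp only [maxSet, minimizers, mem_ofPred_eq,
      eFun_eq_sub_hopfLax hf hconv hφmeas hφbdd hs, sub_le_sub_iff_left, Φ]
  have hcompact : ∀ y s, 0 < s → IsCompact (minimizers f (deriv f) Φ y s) := fun y s hs =>
    isCompact_Icc.of_isClosed_subset (isClosed_minimizers hf1.continuous hc hΦ y s)
      (minimizers_subset_Icc hT hΦ hs)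
  have hnonempty : ∀ y s, 0 < s → (minimizers f (deriv f) Φ y s).Nonempty := fun y s hs =>
    nonempty_minimizers hT hf1.continuous hc hM hΦ hs
  intro t ht
  have htpos : 0 < t := ht₀.trans_lt ht
  have hlt := hjump t ht
  have ha : IsGreatest (minimizers f (deriv f) Φ (x t) t) (uMinus f φ (x t) t) := by
    rw [uMinus, hset _ _ htpos]
    exact (hcompact _ _ htpos).isGreatest_sSup (hnonempty _ _ htpos)
  have hb : IsLeast (minimizers f (deriv f) Φ (x t) t) (uPlus f φ (x t) t) := by
    rw [uPlus, hset _ _ htpos]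
    exact (hcompact _ _ htpos).isLeast_sInf (hnonempty _ _ htpos)
  refine ⟨tendsto_slope_of_discontinuity_curve hT hf1.continuous hc hM hΦ htpos
    (hxcont.mono fun s hs => ht.trans_le hs) ?_ ha hb hlt, ?_, ?_⟩
  · intro τ hτ hsub
    have hτ' : t₀ < τ := ht.trans_le hτ
    have hτpos : 0 < τ := htpos.trans_le hτ
    have h := hjump τ hτ'
    rw [uPlus, uMinus, hset _ _ hτpos] at h
    exact h.ne (hsub ((hcompact _ _ hτpos).sInf_mem (hnonempty _ _ hτpos))
      ((hcompact _ _ hτpos).sSup_mem (hnonempty _ _ hτpos)))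
  · rw [lt_div_iff₀ (sub_pos.2 hlt)]
    linarith [hT _ _ hlt.ne]
  · rw [div_lt_iff₀ (sub_pos.2 hlt)]
    linarith [hT _ _ hlt.ne']
end

section
/- (Centered compression wave inside the backward characteristic triangle and recovery of the initial data.) Let (x₀,t₀) ∈ ℝ × (0,∞) and let a < b with the open interval (a,b) contained in 𝒰(x₀,t₀). Then: (i) for every c ∈ (a,b) and every t ∈ (0,t₀), u⁻(x₀ + (t−t₀)·f'(c), t) = u⁺(x₀ + (t−t₀)·f'(c), t) = c; equivalently, for every t ∈ (0,t₀) and every x strictly between x₀ + (t−t₀)·f'(b) and x₀ + (t−t₀)·f'(a), the value u⁺(x,t) is the unique solution u of f'(u) = (x − x₀)/(t − t₀); (ii) for almost every x in the interval [x₀ − t₀·f'(b), x₀ − t₀·f'(a)], f'(φ(x)) = (x₀ − x)/t₀. -/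
open MeasureTheory Filter Set

/-- The Legendre-type primitive of `s * f'' s` that vanishes at `0`. -/
noncomputable def legendrePrimitive (f : ℝ → ℝ) (u : ℝ) : ℝ := u * deriv f u - f u + f 0

theorem hasDerivAt_deriv_of_contDiff_two {f : ℝ → ℝ} (hf : ContDiff ℝ 2 f) (u : ℝ) :
    HasDerivAt (deriv f) (deriv (deriv f) u) u :=
  ((hf.deriv' (n := 1)).differentiable one_ne_zero u).hasDerivAt

theorem continuous_deriv_deriv_of_contDiff_two {f : ℝ → ℝ} (hf : ContDiff ℝ 2 f) :
    Continuous (deriv (deriv f)) :=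
  (hf.deriv' (n := 1)).continuous_deriv le_rfl

theorem strictMono_of_deriv_nonneg_of_volume_zero {g : ℝ → ℝ} (hg : Differentiable ℝ g)
    (hnonneg : ∀ u, 0 ≤ deriv g u) (hzero : volume {u : ℝ | deriv g u = 0} = 0) :
    StrictMono g := by
  have hmono : Monotone g := monotone_of_deriv_nonneg hg hnonneg
  refine hmono.strictMono_of_injective fun u v huv => ?_
  have key : ∀ {u v : ℝ}, g u = g v → ¬ u < v := by
    intro u v huv hlt
    have hsub : Ioo u v ⊆ {u : ℝ | deriv g u = 0} := by
      intro w hw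
      have heq : g =ᶠ[nhds w] fun _ => g u := by
        filter_upwards [Ioo_mem_nhds hw.1 hw.2] with z hz
        exact le_antisymm ((hmono hz.2.le).trans_eq huv.symm) (hmono hz.1.le)
      simpa using heq.deriv_eq
    have hvol := measure_mono_null hsub hzero
    rw [Real.volume_Ioo, ENNReal.ofReal_eq_zero] at hvol
    linarith
  rcases lt_trichotomy u v with h | h | h
  · exact absurd h (key huv)
  · exact h
  · exact absurd h (key huv.symm)

theorem integral_mul_deriv_deriv_eq_legendrePrimitive {f : ℝ → ℝ} (hf : ContDiff ℝ 2 f) (u : ℝ) :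
    ∫ s in (0:ℝ)..u, deriv (deriv f) s * s = legendrePrimitive f u := by
  have hd : ∀ s : ℝ, HasDerivAt (legendrePrimitive f) (deriv (deriv f) s * s) s := by
    intro s
    have h := (((hasDerivAt_id s).mul (hasDerivAt_deriv_of_contDiff_two hf s)).sub
      (hf.differentiable two_ne_zero s).hasDerivAt).add_const (f 0)
    refine h.congr_deriv ?_
    simp only [id]
    ring
  rw [intervalIntegral.integral_eq_sub_of_hasDerivAt (fun s _ => hd s)
    (((continuous_deriv_deriv_of_contDiff_two hf).mul continuous_id).intervalIntegrable _ _)]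
  simp [legendrePrimitive]

theorem intervalIntegrable_of_measurable_of_abs_le {φ : ℝ → ℝ} {M : ℝ} (hφ : Measurable φ)
    (hM : ∀ x, |φ x| ≤ M) (a b : ℝ) : IntervalIntegrable φ volume a b := by
  refine (intervalIntegrable_const (c := M)).mono_fun hφ.aestronglyMeasurable ?_
  filter_upwards with x
  simpa using (hM x).trans (le_abs_self M)

theorem eFun_eq_sub_legendrePrimitive {f φ : ℝ → ℝ} {M : ℝ} (hf : ContDiff ℝ 2 f)
    (hconv : ∀ u, 0 ≤ deriv (deriv f) u) (hφ : Measurable φ) (hM : ∀ x, |φ x| ≤ M)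
    {t : ℝ} (ht : 0 ≤ t) (u x : ℝ) :
    eFun f φ u x t = (∫ y in (0:ℝ)..(x - t * deriv f 0), φ y)
      - ((∫ y in (0:ℝ)..(x - t * deriv f u), φ y) + t * legendrePrimitive f u) := by
  have hint := intervalIntegrable_of_measurable_of_abs_le hφ hM
  have hcd := continuous_deriv_deriv_of_contDiff_two hf
  have hd (s : ℝ) : HasDerivAt (fun s => x - t * deriv f s) (-(t * deriv (deriv f) s)) s :=
    ((hasDerivAt_deriv_of_contDiff_two hf s).const_mul t).const_sub x
  have hcont : Continuous fun s => x - t * deriv f s :=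
    continuous_iff_continuousAt.2 fun s => (hd s).continuousAt
  have hcomp : IntervalIntegrable (fun s => φ (x - t * deriv f s)) volume 0 u :=
    intervalIntegrable_of_measurable_of_abs_le (hφ.comp hcont.measurable) (fun s => hM _) 0 u
  have hchange := intervalIntegral.integral_comp_mul_deriv_of_deriv_nonpos (a := 0) (b := u)
    (g := φ) hcont.continuousOn (fun s _ => hd s)
    (fun s _ => neg_nonpos.2 (mul_nonneg ht (hconv s)))
  have hchange' : t * ∫ s in (0:ℝ)..u, deriv (deriv f) s * φ (x - t * deriv f s)
      = -∫ y in (x - t * deriv f 0)..(x - t * deriv f u), φ y := by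
    rw [← hchange, ← intervalIntegral.integral_const_mul, ← intervalIntegral.integral_neg]
    refine intervalIntegral.integral_congr fun s _ => ?_
    simp only [Function.comp]
    ring
  have hsplit := intervalIntegral.integral_interval_sub_left
    (hint 0 (x - t * deriv f u)) (hint 0 (x - t * deriv f 0))
  simp only [eFun, mul_sub]
  rw [intervalIntegral.integral_sub (hcomp.continuousOn_mul hcd.continuousOn)
    (Continuous.intervalIntegrable (by fun_prop) _ _), mul_sub, hchange',
    integral_mul_deriv_deriv_eq_legendrePrimitive hf, ← hsplit]
  ring

theorem mem_maxSet_iff {f φ : ℝ → ℝ} {M : ℝ} (hf : ContDiff ℝ 2 f)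
    (hconv : ∀ u, 0 ≤ deriv (deriv f) u) (hφ : Measurable φ) (hM : ∀ x, |φ x| ≤ M)
    {t : ℝ} (ht : 0 ≤ t) (w x : ℝ) :
    w ∈ maxSet f φ x t ↔ ∀ v : ℝ,
      (∫ y in (0:ℝ)..(x - t * deriv f w), φ y) + t * legendrePrimitive f w ≤
        (∫ y in (0:ℝ)..(x - t * deriv f v), φ y) + t * legendrePrimitive f v := by
  simp only [maxSet, mem_ofPred_eq, eFun_eq_sub_legendrePrimitive hf hconv hφ hM ht,
    sub_le_sub_iff_left]

theorem mul_sub_deriv_lt_legendrePrimitive_sub {f : ℝ → ℝ} (hf : ContDiff ℝ 2 f)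
    (hmono : StrictMono (deriv f)) {u w : ℝ} (h : u ≠ w) :
    w * (deriv f u - deriv f w) < legendrePrimitive f u - legendrePrimitive f w := by
  have hconvex : StrictConvexOn ℝ univ f := hmono.strictConvexOn_univ_of_deriv hf.continuous
  have hd := (hf.differentiable two_ne_zero u).hasDerivAt
  have htangent : deriv f u * (w - u) < f w - f u := by
    rcases h.lt_or_gt with h | h
    · have := hconvex.lt_slope_of_hasDerivAt (mem_univ u) (mem_univ w) h hd
      rwa [slope_def_field, lt_div_iff₀ (sub_pos.2 h)] at this
    · have := hconvex.slope_lt_of_hasDerivAt (mem_univ w) (mem_univ u) h hd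
      rw [slope_def_field, div_lt_iff₀ (sub_pos.2 h)] at this
      linarith
  simp only [legendrePrimitive]
  linarith

/-- A maximizer at `(x₀, t₀)` is the only maximizer at earlier points of its characteristic. -/
theorem maxSet_eq_singleton_of_mem_maxSet {f φ : ℝ → ℝ} {M : ℝ} (hf : ContDiff ℝ 2 f)
    (hconv : ∀ u, 0 ≤ deriv (deriv f) u) (hmono : StrictMono (deriv f))
    (hφ : Measurable φ) (hM : ∀ x, |φ x| ≤ M) {x₀ t₀ t c : ℝ} (ht : t ∈ Ioo 0 t₀)
    (hc : c ∈ maxSet f φ x₀ t₀) :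
    maxSet f φ (x₀ + (t - t₀) * deriv f c) t = {c} := by
  obtain ⟨ht0, htt⟩ := ht
  have ht₀ : 0 < t₀ := ht0.trans htt
  rw [mem_maxSet_iff hf hconv hφ hM ht₀.le] at hc
  have hcontinuous : Continuous (deriv f) := hf.continuous_deriv one_le_two
  have hfoot : x₀ + (t - t₀) * deriv f c - t * deriv f c = x₀ - t₀ * deriv f c := by ring
  have hstrict : ∀ v, v ≠ c →
      (∫ y in (0:ℝ)..(x₀ + (t - t₀) * deriv f c - t * deriv f c), φ y)
        + t * legendrePrimitive f c <
      (∫ y in (0:ℝ)..(x₀ + (t - t₀) * deriv f c - t * deriv f v), φ y)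
        + t * legendrePrimitive f v := by
    intro v hv
    have hsegment : t₀⁻¹ * (t * deriv f v + (t₀ - t) * deriv f c) ∈
        uIcc (deriv f c) (deriv f v) := by
      have h₁ : t₀⁻¹ * (t * deriv f v + (t₀ - t) * deriv f c) - deriv f c
          = t₀⁻¹ * t * (deriv f v - deriv f c) := by field_simp; ring
      have h₂ : deriv f v - t₀⁻¹ * (t * deriv f v + (t₀ - t) * deriv f c)
          = t₀⁻¹ * (t₀ - t) * (deriv f v - deriv f c) := by field_simp; ring
      have hp₁ : 0 ≤ t₀⁻¹ * t := by positivity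
      have hp₂ : 0 ≤ t₀⁻¹ * (t₀ - t) := mul_nonneg (by positivity) (by linarith)
      rw [mem_uIcc]
      rcases le_total (deriv f c) (deriv f v) with h | h
      · left
        exact ⟨by nlinarith, by nlinarith⟩
      · right
        exact ⟨by nlinarith, by nlinarith⟩
    obtain ⟨w, -, hw⟩ := intermediate_value_uIcc hcontinuous.continuousOn hsegment
    have hw' : t₀ * deriv f w = t * deriv f v + (t₀ - t) * deriv f c := by
      rw [hw]
      field_simp
    have hwv : v ≠ w := by
      rintro rfl
      have : (t₀ - t) * (deriv f v - deriv f c) = 0 := by linarith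
      rcases mul_eq_zero.1 this with h | h
      · linarith
      · exact hv (hmono.injective (sub_eq_zero.1 h))
    have hwc : c ≠ w := by
      rintro rfl
      have : t * (deriv f v - deriv f c) = 0 := by linarith
      rcases mul_eq_zero.1 this with h | h
      · linarith
      · exact hv (hmono.injective (sub_eq_zero.1 h))
    have h₁ := mul_lt_mul_of_pos_left (mul_sub_deriv_lt_legendrePrimitive_sub hf hmono hwv) ht0
    have h₂ := mul_lt_mul_of_pos_left (mul_sub_deriv_lt_legendrePrimitive_sub hf hmono hwc)
      (sub_pos.2 htt)
    have hsum : t * (w * (deriv f v - deriv f w)) + (t₀ - t) * (w * (deriv f c - deriv f w)) = 0 := by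
      linear_combination -w * hw'
    have hmin := hc w
    rw [hfoot, show x₀ + (t - t₀) * deriv f c - t * deriv f v = x₀ - t₀ * deriv f w by
      rw [hw']; ring]
    linarith
  ext v
  rw [mem_maxSet_iff hf hconv hφ hM ht0.le, mem_singleton_iff]
  constructor
  · intro h
    by_contra hv
    exact (h c).not_gt (hstrict v hv)
  · intro hvc u
    rw [hvc]
    rcases eq_or_ne u c with rfl | hu
    · exact le_rfl
    · exact (hstrict u hu).le

theorem exists_mem_Ioo_deriv_eq {f : ℝ → ℝ} (hcont : Continuous (deriv f)) {a b p : ℝ}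
    (hab : a < b) (ha : deriv f a < p) (hb : p < deriv f b) :
    ∃ c ∈ Ioo a b, deriv f c = p :=
  intermediate_value_Ioo hab.le hcont.continuousOn ⟨ha, hb⟩

/-- At a differentiability point of its primitive, the datum is the foot value of the wave. -/
theorem deriv_apply_eq_of_Ioo_subset_maxSet {f φ : ℝ → ℝ} {M : ℝ} (hf : ContDiff ℝ 2 f)
    (hconv : ∀ u, 0 ≤ deriv (deriv f) u) (hmono : StrictMono (deriv f))
    (hφ : Measurable φ) (hM : ∀ x, |φ x| ≤ M) {x₀ t₀ a b y : ℝ} (ht₀ : 0 < t₀) (hab : a < b)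
    (hsub : Ioo a b ⊆ maxSet f φ x₀ t₀)
    (hy : y ∈ Ioo (x₀ - t₀ * deriv f b) (x₀ - t₀ * deriv f a))
    (hderiv : HasDerivAt (fun z => ∫ s in (0:ℝ)..z, φ s) (φ y) y) :
    deriv f (φ y) = (x₀ - y) / t₀ := by
  have hfoot : ∀ z ∈ Ioo (x₀ - t₀ * deriv f b) (x₀ - t₀ * deriv f a),
      ∃ c ∈ Ioo a b, deriv f c = (x₀ - z) / t₀ ∧ x₀ - t₀ * deriv f c = z := by
    intro z hz
    obtain ⟨c, hc, hcz⟩ := exists_mem_Ioo_deriv_eq (p := (x₀ - z) / t₀)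
      (hf.continuous_deriv one_le_two) hab
      (by rw [lt_div_iff₀ ht₀]; linarith [hz.2]) (by rw [div_lt_iff₀ ht₀]; linarith [hz.1])
    refine ⟨c, hc, hcz, ?_⟩
    rw [hcz]
    field_simp
    ring
  obtain ⟨c, -, hcy, hc⟩ := hfoot y hy
  have hmax : IsLocalMax (fun z => (∫ s in (0:ℝ)..z, φ s) - z * c) y := by
    filter_upwards [Ioo_mem_nhds hy.1 hy.2] with z hz
    obtain ⟨d, hd, -, hdz⟩ := hfoot z hz
    have hle := (mem_maxSet_iff hf hconv hφ hM ht₀.le d x₀).1 (hsub hd) c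
    have hsubgradient : c * (deriv f d - deriv f c) ≤
        legendrePrimitive f d - legendrePrimitive f c := by
      rcases eq_or_ne d c with rfl | h
      · simp
      · exact (mul_sub_deriv_lt_legendrePrimitive_sub hf hmono h).le
    have hscaled := mul_le_mul_of_nonneg_left hsubgradient ht₀.le
    have hlin : t₀ * (c * (deriv f d - deriv f c)) = y * c - z * c := by
      rw [← hdz, ← hc]
      ring
    rw [hdz, hc] at hle
    linarith
  have hzero := hmax.hasDerivAt_eq_zero (hderiv.sub ((hasDerivAt_id y).mul_const c))
  rw [← hcy, show φ y = c by linarith]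

/-- centered compression wave inside the backward characteristic
triangle and recovery of the initial data. -/
theorem stmt18_centered_compression_wave
    (f φ : ℝ → ℝ) (M : ℝ)
    (hf : ContDiff ℝ 2 f)
    (hconv : ∀ u : ℝ, 0 ≤ deriv (deriv f) u)
    (hdeg : volume {u : ℝ | deriv (deriv f) u = 0} = 0)
    (hφmeas : Measurable φ)
    (hφbdd : ∀ x : ℝ, |φ x| ≤ M)
    (x₀ t₀ a b : ℝ) (ht₀ : 0 < t₀) (hab : a < b)
    (hsub : Set.Ioo a b ⊆ maxSet f φ x₀ t₀) :
    (∀ c ∈ Set.Ioo a b, ∀ t ∈ Set.Ioo (0:ℝ) t₀,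
      uMinus f φ (x₀ + (t - t₀) * deriv f c) t = c ∧
      uPlus f φ (x₀ + (t - t₀) * deriv f c) t = c) ∧
    (∀ t ∈ Set.Ioo (0:ℝ) t₀, ∀ x : ℝ,
      x₀ + (t - t₀) * deriv f b < x → x < x₀ + (t - t₀) * deriv f a →
      deriv f (uPlus f φ x t) = (x - x₀) / (t - t₀) ∧
      ∀ u : ℝ, deriv f u = (x - x₀) / (t - t₀) → u = uPlus f φ x t) ∧
    (∀ᵐ x ∂(volume.restrict (Set.Icc (x₀ - t₀ * deriv f b) (x₀ - t₀ * deriv f a))),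
      deriv f (φ x) = (x₀ - x) / t₀) := by
  have hmono : StrictMono (deriv f) := strictMono_of_deriv_nonneg_of_volume_zero
    (fun u => (hasDerivAt_deriv_of_contDiff_two hf u).differentiableAt) hconv hdeg
  have hsingle (c : ℝ) (hc : c ∈ Ioo a b) (t : ℝ) (ht : t ∈ Ioo 0 t₀) :=
    maxSet_eq_singleton_of_mem_maxSet hf hconv hmono hφmeas hφbdd ht (hsub hc)
  refine ⟨?_, ?_, ?_⟩
  · intro c hc t ht
    simp [uMinus, uPlus, hsingle c hc t ht]
  · intro t ht x hxb hxa
    have hneg : t - t₀ < 0 := sub_neg.2 ht.2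
    obtain ⟨c, hc, hcx⟩ := exists_mem_Ioo_deriv_eq (p := (x - x₀) / (t - t₀))
      (hf.continuous_deriv one_le_two) hab
      (by rw [lt_div_iff_of_neg hneg]; linarith) (by rw [div_lt_iff_of_neg hneg]; linarith)
    have hx : x₀ + (t - t₀) * deriv f c = x := by
      rw [hcx, mul_div_cancel₀ _ hneg.ne]
      ring
    have huc : uPlus f φ x t = c := by
      have := hsingle c hc t ht
      rw [hx] at this
      simp [uPlus, this]
    rw [huc]
    exact ⟨hcx, fun u hu => hmono.injective (hu.trans hcx.symm)⟩
  · rw [← restrict_Ioo_eq_restrict_Icc, ae_restrict_iff' measurableSet_Ioo]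
    have hloc : LocallyIntegrable φ volume :=
      (locallyIntegrable_const M).mono hφmeas.aestronglyMeasurable
        (.of_forall fun y => (hφbdd y).trans (le_abs_self M))
    filter_upwards [LocallyIntegrable.ae_hasDerivAt_integral hloc] with y hy hmem
    exact deriv_apply_eq_of_Ioo_subset_maxSet hf hconv hmono hφmeas hφbdd ht₀ hab hsub hmem (hy 0)
end
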